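/- Let $Q_t := \{(u_0,u_1,u_2) \in \mathbb{R}_{\geq 0}^3 \mid u_0+u_1+u_2 \leq 1 \text{ and } 3u_0+u_2 \geq t\}$. Then the Lebesgue volume of $Q_t$ satisfies: $\mathrm{vol}(Q_t) = \frac{1}{6} - \frac{1}{6}t^2 + \frac{2}{27}t^3$ if $0 \leq t \leq 1$; $\mathrm{vol}(Q_t) = \frac{1}{108}(3-t)^3$ if $1 \leq t \leq 3$; and $\mathrm{vol}(Q_t) = 0$ if $t \geq 3$. -/

import Mathlib

open MeasureTheory

/-- The region `Q_t = {u ∈ ℝ³_{≥0} | u₀+u₁+u₂ ≤ 1 and 3u₀+u₂ ≥ t}`. -/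
def Qreg (t : ℝ) : Set (Fin 3 → ℝ) :=
  {u | (∀ i, 0 ≤ u i) ∧ u 0 + u 1 + u 2 ≤ 1 ∧ t ≤ 3 * u 0 + u 2}

theorem setLIntegral_Ici_ofReal_eq_intervalIntegral {f : ℝ → ℝ} {c : ℝ} (hc : 0 ≤ c)
    (hf : Continuous f) (hpos : ∀ x ∈ Set.Ioc 0 c, 0 ≤ f x) (hneg : ∀ x, c < x → f x ≤ 0) :
    ∫⁻ x in Set.Ici 0, ENNReal.ofReal (f x) = ENNReal.ofReal (∫ x in (0 : ℝ)..c, f x) := by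
  rw [intervalIntegral.integral_of_le hc, ofReal_integral_eq_lintegral_ofReal
      (hf.integrableOn_Ioc) ((ae_restrict_iff' measurableSet_Ioc).2 (ae_of_all _ hpos)),
    setLIntegral_congr Ioi_ae_eq_Ici.symm, ← Set.Ioc_union_Ioi_eq_Ioi hc,
    lintegral_union measurableSet_Ioi (Set.Ioc_disjoint_Ioi le_rfl),
    setLIntegral_eq_zero (s := Set.Ioi c) measurableSet_Ioi, add_zero]
  intro x hx
  simpa using hneg x hx

theorem setLIntegral_Ici_ofReal_sub (c : ℝ) :
    ∫⁻ y in Set.Ici (0 : ℝ), ENNReal.ofReal (c - y) = ENNReal.ofReal ((max c 0) ^ 2 / 2) := by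
  rcases le_total 0 c with hc | hc
  · rw [setLIntegral_Ici_ofReal_eq_intervalIntegral hc (by fun_prop)
      (fun x hx => sub_nonneg.2 hx.2) (fun x hx => by linarith), max_eq_left hc]
    congr 1
    rw [intervalIntegral.integral_sub (by simp) (by simp)]
    simp
    ring
  · rw [setLIntegral_eq_zero measurableSet_Ici, max_eq_right hc]
    · simp
    · intro y hy
      have : (0 : ℝ) ≤ y := hy
      simp only [Pi.zero_apply, ENNReal.ofReal_eq_zero]
      linarith

theorem measurableSet_prodRegion (t : ℝ) :
    MeasurableSet {p : ℝ × ℝ × ℝ | 0 ≤ p.1 ∧ 0 ≤ p.2.1 ∧ 0 ≤ p.2.2 ∧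
      p.1 + p.2.1 + p.2.2 ≤ 1 ∧ t ≤ 3 * p.1 + p.2.2} := by
  measurability

theorem volume_Qreg_eq_volume_prod (t : ℝ) :
    volume (Qreg t) = volume {p : ℝ × ℝ × ℝ | 0 ≤ p.1 ∧ 0 ≤ p.2.1 ∧ 0 ≤ p.2.2 ∧
      p.1 + p.2.1 + p.2.2 ≤ 1 ∧ t ≤ 3 * p.1 + p.2.2} := by
  have h := ((MeasurePreserving.id (volume : Measure ℝ)).prod
    (volume_preserving_finTwoArrow ℝ)).comp (volume_preserving_piFinSuccAbove (fun _ => ℝ) 0)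
  rw [← Measure.volume_eq_prod] at h
  rw [← h.measure_preimage (measurableSet_prodRegion t).nullMeasurableSet]
  congr 1
  ext u
  simp [Qreg, Fin.forall_fin_succ, MeasurableEquiv.piFinSuccAbove, MeasurableEquiv.finTwoArrow,
    Fin.tail, and_assoc]

theorem volume_Qreg_eq_lintegral (t : ℝ) :
    volume (Qreg t) = ∫⁻ x in Set.Ici (0 : ℝ),
      ENNReal.ofReal ((max (1 - x - max 0 (t - 3 * x)) 0) ^ 2 / 2) := by
  rw [volume_Qreg_eq_volume_prod, Measure.volume_eq_prod, Measure.prod_apply (measurableSet_prodRegion t),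
    ← lintegral_indicator measurableSet_Ici]
  congr 1 with x
  rw [Measure.volume_eq_prod, Measure.prod_apply (measurable_prodMk_left (measurableSet_prodRegion t))]
  by_cases hx : 0 ≤ x
  · rw [Set.indicator_of_mem (Set.mem_Ici.2 hx), ← setLIntegral_Ici_ofReal_sub,
      ← lintegral_indicator measurableSet_Ici]
    congr 1 with y
    by_cases hy : 0 ≤ y
    · rw [Set.indicator_of_mem (Set.mem_Ici.2 hy)]
      trans volume (Set.Icc (max 0 (t - 3 * x)) (1 - x - y))
      · congr 1
        ext z
        simp only [Set.mem_preimage, Set.mem_ofPred_eq, Set.mem_Icc, max_le_iff]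
        constructor
        · rintro ⟨-, -, h1, h2, h3⟩
          exact ⟨⟨h1, by linarith⟩, by linarith⟩
        · rintro ⟨⟨h1, h2⟩, h3⟩
          exact ⟨hx, hy, h1, by linarith, by linarith⟩
      · rw [Real.volume_Icc]
        congr 1
        ring
    · simp [hy]
  · simp [hx]

theorem volume_Qreg_toReal (t : ℝ) :
    (volume (Qreg t)).toReal =
      ∫ x in (0 : ℝ)..1, (max (1 - x - max 0 (t - 3 * x)) 0) ^ 2 / 2 := by
  rw [volume_Qreg_eq_lintegral, setLIntegral_Ici_ofReal_eq_intervalIntegral zero_le_one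
    (by fun_prop) (fun _ _ => by positivity), ENNReal.toReal_ofReal]
  · exact intervalIntegral.integral_nonneg zero_le_one fun _ _ => by positivity
  · intro x hx
    rw [max_eq_right]
    · simp
    · linarith [le_max_left 0 (t - 3 * x)]

theorem integral_sq_section_lower {t a : ℝ} (ha : (t - 1) / 2 ≤ a) (hat : a ≤ t / 3) :
    ∫ x in a..(t / 3), (max (1 - x - max 0 (t - 3 * x)) 0) ^ 2 / 2 =
      ((1 - t / 3) ^ 3 - (1 - t + 2 * a) ^ 3) / 12 := by
  have h : ∀ x ∈ Set.uIcc a (t / 3), HasDerivAt (fun x : ℝ => (1 - t + 2 * x) ^ 3 / 12)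
      ((max (1 - x - max 0 (t - 3 * x)) 0) ^ 2 / 2) x := by
    intro x hx
    rw [Set.uIcc_of_le hat] at hx
    rw [max_eq_right (by linarith [hx.2] : 0 ≤ t - 3 * x), max_eq_left (by linarith [hx.1])]
    refine (((((hasDerivAt_id x).const_mul 2).const_add (1 - t)).pow 3).div_const 12).congr_deriv ?_
    norm_num [id]
    ring
  rw [intervalIntegral.integral_eq_sub_of_hasDerivAt h
    (Continuous.intervalIntegrable (by fun_prop) _ _)]
  ring

theorem integral_sq_section_upper {t : ℝ} (ht : t ≤ 3) :
    ∫ x in (t / 3)..1, (max (1 - x - max 0 (t - 3 * x)) 0) ^ 2 / 2 = (1 - t / 3) ^ 3 / 6 := by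
  have h : ∀ x ∈ Set.uIcc (t / 3) 1, HasDerivAt (fun x : ℝ => -(1 - x) ^ 3 / 6)
      ((max (1 - x - max 0 (t - 3 * x)) 0) ^ 2 / 2) x := by
    intro x hx
    rw [Set.uIcc_of_le (by linarith)] at hx
    rw [max_eq_left (by linarith [hx.1] : t - 3 * x ≤ 0), max_eq_left (by linarith [hx.2])]
    refine ((((hasDerivAt_id x).const_sub 1).pow 3).neg.div_const 6).congr_deriv ?_
    norm_num [id]
    ring
  rw [intervalIntegral.integral_eq_sub_of_hasDerivAt h
    (Continuous.intervalIntegrable (by fun_prop) _ _)]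
  ring

theorem integral_sq_section_eq_zero {t a : ℝ} (h0 : 0 ≤ a) (ha : a ≤ (t - 1) / 2) :
    ∫ x in (0 : ℝ)..a, (max (1 - x - max 0 (t - 3 * x)) 0) ^ 2 / 2 = 0 := by
  apply intervalIntegral.integral_zero_ae
  refine ae_of_all _ fun x hx => ?_
  rw [Set.uIoc_of_le h0] at hx
  rw [max_eq_right]
  · simp
  · linarith [hx.2, le_max_right 0 (t - 3 * x)]

theorem stmt_0 (t : ℝ) :
    (0 ≤ t → t ≤ 1 →
      (volume (Qreg t)).toReal = 1/6 - 1/6 * t^2 + 2/27 * t^3) ∧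
    (1 ≤ t → t ≤ 3 →
      (volume (Qreg t)).toReal = 1/108 * (3 - t)^3) ∧
    (3 ≤ t → (volume (Qreg t)).toReal = 0) := by
  have hint (a b : ℝ) : IntervalIntegrable
      (fun x => (max (1 - x - max 0 (t - 3 * x)) 0) ^ 2 / 2) volume a b :=
    Continuous.intervalIntegrable (by fun_prop) _ _
  rw [volume_Qreg_toReal]
  refine ⟨fun h0 h1 => ?_, fun h1 h3 => ?_, fun h3 => ?_⟩
  · rw [← intervalIntegral.integral_add_adjacent_intervals (hint 0 (t / 3)) (hint (t / 3) 1),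
      integral_sq_section_lower (by linarith) (by linarith),
      integral_sq_section_upper (by linarith)]
    ring
  · rw [← intervalIntegral.integral_add_adjacent_intervals (hint 0 (t / 3)) (hint (t / 3) 1),
      ← intervalIntegral.integral_add_adjacent_intervals (hint 0 ((t - 1) / 2))
        (hint ((t - 1) / 2) (t / 3)),
      integral_sq_section_eq_zero (by linarith) le_rfl,
      integral_sq_section_lower le_rfl (by linarith), integral_sq_section_upper h3]
    ring
  · exact integral_sq_section_eq_zero zero_le_one (by linarith)
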